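/- Let N ≥ 2 and s ∈ (0,1). For every φ ∈ 𝕏_s(ℝ^N_+), lim_{ε→0^+} ∫_{ℝ^N_+} ε^{−s} 𝒢_{s,∞}(x, ε e_1) (−Δ)^s φ(x) dx = ∫_{ℝ^N_+} 𝒫_s(x) (−Δ)^s φ(x) dx. -/

import Mathlib

open MeasureTheory Real Filter Set Topology

noncomputable section

/-- The normalizing constant `c_{N,s}` of the fractional Laplacian. -/
def cns (N : ℕ) (s : ℝ) : ℝ :=
  (2 : ℝ) ^ (2 * s) * Real.pi ^ (-(N : ℝ) / 2) * s *
    Real.Gamma (((N : ℝ) + 2 * s) / 2) / Real.Gamma (1 - s)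

/-- The annulus `{z : ε < |z| < 1/ε}` in `ℝ^N`. -/
def annulus (N : ℕ) (ε : ℝ) : Set (EuclideanSpace ℝ (Fin N)) :=
  {z | ε < ‖z‖ ∧ ‖z‖ < 1 / ε}

/-- The truncated fractional-Laplacian integral
`∫_{ε<|z|<1/ε} (u(x) - u(x+z)) |z|^{-N-2s} dz` (without the normalizing constant). -/
def pvInt (N : ℕ) (s : ℝ) (u : EuclideanSpace ℝ (Fin N) → ℝ)
    (x : EuclideanSpace ℝ (Fin N)) (ε : ℝ) : ℝ :=
  ∫ z in annulus N ε, (u x - u (x + z)) / ‖z‖ ^ ((N : ℝ) + 2 * s)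

/-- `u` is `s`-harmonic at `x` in the principal value sense:
`lim_{ε→0⁺} c_{N,s} ∫_{ε<|z|<1/ε} (u(x) - u(x+z)) |z|^{-N-2s} dz = 0`. -/
def SHarmonicAt (N : ℕ) (s : ℝ) (u : EuclideanSpace ℝ (Fin N) → ℝ)
    (x : EuclideanSpace ℝ (Fin N)) : Prop :=
  Tendsto (fun ε : ℝ => cns N s * pvInt N s u x ε) (𝓝[>] (0 : ℝ)) (𝓝 0)

/-- The constant `κ_{N,s} = π^{-(N/2+1)} Γ(N/2) sin(πs)`. -/
def kap (N : ℕ) (s : ℝ) : ℝ :=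
  Real.pi ^ (-((N : ℝ) / 2 + 1)) * Real.Gamma ((N : ℝ) / 2) * Real.sin (Real.pi * s)

/-- The constant `𝒦_s = κ_{N,s} 2^{2s-1} s^{-1}`. -/
def Ks (N : ℕ) (s : ℝ) : ℝ := kap N s * 2 ^ (2 * s - 1) / s

/-- The first coordinate vector `e₁` of `ℝ^N`. -/
def e1 (N : ℕ) [NeZero N] : EuclideanSpace ℝ (Fin N) := EuclideanSpace.single 0 1

/-- The fundamental solution `𝒫_s(x) = 𝒦_s x₁^s |x|^{-N}` on `ℝ^N_+`, zero elsewhere. -/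
def Ps (N : ℕ) [NeZero N] (s : ℝ) (x : EuclideanSpace ℝ (Fin N)) : ℝ :=
  if 0 < x 0 then Ks N s * (x 0) ^ s * ‖x‖ ^ (-(N : ℝ)) else 0

/-- The Green kernel `𝒢_{s,∞}` of the fractional Laplacian in the half-space. -/
def Gs (N : ℕ) [NeZero N] (s : ℝ) (x y : EuclideanSpace ℝ (Fin N)) : ℝ :=
  if 0 < x 0 ∧ 0 < y 0 then
    (kap N s / 2) * ‖x - y‖ ^ (2 * s - (N : ℝ)) *
      ∫ t in Ioo (0 : ℝ) (4 * x 0 * y 0 / ‖x - y‖ ^ 2),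
        t ^ (s - 1) * (1 + t) ^ (-(N : ℝ) / 2)
  else 0

/-- The test-function space `𝕏_s(ℝ^N_+)`: `ξ` belongs to it, with `L` the (everywhere on
`ℝ^N_+` existing, bounded) principal-value fractional Laplacian `(-Δ)^s ξ`. -/
structure TestFun (N : ℕ) [NeZero N] (s : ℝ)
    (ξ L : EuclideanSpace ℝ (Fin N) → ℝ) : Prop where
  cont : Continuous ξ
  cpt : HasCompactSupport ξ
  supp : tsupport ξ ⊆ {x : EuclideanSpace ℝ (Fin N) | 0 ≤ x 0}
  quot : ∃ g : EuclideanSpace ℝ (Fin N) → ℝ,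
    ContinuousOn g {x : EuclideanSpace ℝ (Fin N) | 0 ≤ x 0} ∧
    ∀ x : EuclideanSpace ℝ (Fin N), 0 < x 0 → g x = (x 0) ^ (-s) * ξ x
  pv : ∀ x : EuclideanSpace ℝ (Fin N), 0 < x 0 →
    Tendsto (fun ε : ℝ => cns N s * pvInt N s ξ x ε) (𝓝[>] (0 : ℝ)) (𝓝 (L x))
  bdd : ∃ C : ℝ, ∀ x : EuclideanSpace ℝ (Fin N), 0 < x 0 → |L x| ≤ C
  dom : ∃ (φ : EuclideanSpace ℝ (Fin N) → ℝ) (ε₀ : ℝ), 0 < ε₀ ∧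
    IntegrableOn (fun x : EuclideanSpace ℝ (Fin N) => φ x * (x 0) ^ s)
      {x : EuclideanSpace ℝ (Fin N) | 0 < x 0} ∧
    ∀ ε ∈ Ioc (0 : ℝ) ε₀, ∀ᵐ x : EuclideanSpace ℝ (Fin N),
      0 < x 0 → |cns N s * pvInt N s ξ x ε| ≤ φ x

/-- The incomplete Beta-type integral `∫_0^r t^{s-1} (1+t)^{-N/2} dt` in the Green kernel. -/
def greenProfile (N : ℕ) (s r : ℝ) : ℝ :=
  ∫ t in Ioo (0 : ℝ) r, t ^ (s - 1) * (1 + t) ^ (-(N : ℝ) / 2)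

lemma integral_Ioo_rpow_sub_one {a r : ℝ} (ha : 0 < a) (hr : 0 ≤ r) :
    ∫ t in Ioo (0 : ℝ) r, t ^ (a - 1) = r ^ a / a := by
  rw [← integral_Ioc_eq_integral_Ioo, ← intervalIntegral.integral_of_le hr,
    integral_rpow (Or.inl (by linarith))]
  simp [Real.zero_rpow ha.ne']

lemma integrableOn_Ioo_rpow_sub_one {a : ℝ} (ha : 0 < a) (r : ℝ) :
    IntegrableOn (fun t : ℝ => t ^ (a - 1)) (Ioo (0 : ℝ) r) := by
  rcases le_or_gt r 0 with hr | hr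
  · simp [Ioo_eq_empty_of_le hr]
  · exact (intervalIntegral.integrableOn_Ioo_rpow_iff hr).2 (by linarith)

/-- For `0 ≤ b ≤ N/2` the integrand of `greenProfile` is at most `t^{s-b-1}`. -/
lemma greenIntegrand_le {N : ℕ} {s b t : ℝ} (hb : 0 ≤ b) (hbN : b ≤ (N : ℝ) / 2) (ht : 0 < t) :
    t ^ (s - 1) * (1 + t) ^ (-(N : ℝ) / 2) ≤ t ^ (s - b - 1) := by
  have h1 : (1 + t) ^ (-(N : ℝ) / 2) ≤ (1 + t) ^ (-b) :=
    Real.rpow_le_rpow_of_exponent_le (by linarith) (by linarith)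
  have h2 : (1 + t) ^ (-b) ≤ t ^ (-b) :=
    Real.rpow_le_rpow_of_nonpos ht (by linarith) (by linarith)
  calc t ^ (s - 1) * (1 + t) ^ (-(N : ℝ) / 2) ≤ t ^ (s - 1) * t ^ (-b) := by
        gcongr; exact h1.trans h2
    _ = t ^ (s - b - 1) := by rw [← Real.rpow_add ht]; ring_nf

lemma integrableOn_greenIntegrand (N : ℕ) {s : ℝ} (hs : 0 < s) (r : ℝ) :
    IntegrableOn (fun t : ℝ => t ^ (s - 1) * (1 + t) ^ (-(N : ℝ) / 2)) (Ioo (0 : ℝ) r) := by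
  refine (integrableOn_Ioo_rpow_sub_one hs r).mono' (by fun_prop) ?_
  refine (ae_restrict_iff' measurableSet_Ioo).2 (ae_of_all _ fun t ht => ?_)
  have h0 : 0 < t := ht.1
  rw [Real.norm_of_nonneg (by positivity)]
  simpa using greenIntegrand_le (N := N) (s := s) le_rfl (by positivity) h0

lemma greenProfile_nonneg (N : ℕ) (s r : ℝ) : 0 ≤ greenProfile N s r := by
  refine setIntegral_nonneg measurableSet_Ioo fun t ht => ?_
  have h0 : 0 < t := ht.1
  positivity

lemma greenProfile_mono (N : ℕ) {s : ℝ} (hs : 0 < s) : Monotone (greenProfile N s) := by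
  intro r r' h
  refine setIntegral_mono_set (integrableOn_greenIntegrand N hs r') ?_
    (Ioo_subset_Ioo_right h).eventuallyLE
  refine (ae_restrict_iff' measurableSet_Ioo).2 (ae_of_all _ fun t ht => ?_)
  have h0 : 0 < t := ht.1
  simp only [Pi.zero_apply]
  positivity

lemma greenProfile_le {N : ℕ} {s b r : ℝ} (hb : 0 ≤ b) (hbN : b ≤ (N : ℝ) / 2) (hbs : b < s)
    (hr : 0 ≤ r) : greenProfile N s r ≤ r ^ (s - b) / (s - b) := by
  rw [← integral_Ioo_rpow_sub_one (sub_pos.2 hbs) hr]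
  exact setIntegral_mono_on (integrableOn_greenIntegrand N (hb.trans_lt hbs) r)
    (integrableOn_Ioo_rpow_sub_one (sub_pos.2 hbs) r) measurableSet_Ioo
    fun t ht => greenIntegrand_le hb hbN ht.1

lemma le_greenProfile (N : ℕ) {s r : ℝ} (hs : 0 < s) (hr : 0 ≤ r) :
    (1 + r) ^ (-(N : ℝ) / 2) * (r ^ s / s) ≤ greenProfile N s r := by
  rw [← integral_Ioo_rpow_sub_one hs hr, ← integral_const_mul]
  refine setIntegral_mono_on ((integrableOn_Ioo_rpow_sub_one hs r).const_mul _)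
    (integrableOn_greenIntegrand N hs r) measurableSet_Ioo fun t ht => ?_
  have h0 : 0 < t := ht.1
  rw [mul_comm]
  gcongr ?_ * ?_
  exact Real.rpow_le_rpow_of_nonpos (by linarith) (by linarith [ht.2])
    (by have : (0 : ℝ) ≤ N := by positivity
        linarith)

lemma tendsto_greenProfile_div (N : ℕ) {s : ℝ} (hs : 0 < s) :
    Tendsto (fun r : ℝ => greenProfile N s r / r ^ s) (𝓝[>] 0) (𝓝 (1 / s)) := by
  have hlow : Tendsto (fun r : ℝ => (1 + r) ^ (-(N : ℝ) / 2) * (1 / s)) (𝓝[>] 0) (𝓝 (1 / s)) := by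
    have : ContinuousAt (fun r : ℝ => (1 + r) ^ (-(N : ℝ) / 2) * (1 / s)) 0 := by
      refine ContinuousAt.mul (ContinuousAt.rpow_const (by fun_prop) (Or.inl (by simp)))
        continuousAt_const
    simpa [ContinuousAt] using this.tendsto.mono_left nhdsWithin_le_nhds
  refine tendsto_of_tendsto_of_tendsto_of_le_of_le' hlow tendsto_const_nhds ?_ ?_
  · filter_upwards [self_mem_nhdsWithin] with r (hr : 0 < r)
    rw [le_div_iff₀ (by positivity)]
    exact (le_of_eq (by ring)).trans (le_greenProfile N hs hr.le)
  · filter_upwards [self_mem_nhdsWithin] with r (hr : 0 < r)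
    rw [div_le_iff₀ (by positivity)]
    have h := greenProfile_le (N := N) le_rfl (by positivity) hs hr.le
    rw [sub_zero] at h
    exact h.trans_eq (by ring)

lemma abs_apply_zero_le_norm {N : ℕ} [NeZero N] (x : EuclideanSpace ℝ (Fin N)) :
    |x 0| ≤ ‖x‖ := by
  simpa using PiLp.norm_apply_le x 0

lemma norm_smul_e1 (N : ℕ) [NeZero N] {ε : ℝ} (hε : 0 ≤ ε) : ‖ε • e1 N‖ = ε := by
  simp [e1, norm_smul, abs_of_nonneg hε]

lemma Gs_smul_e1 {N : ℕ} [NeZero N] {s ε : ℝ} (hε : 0 < ε) {x : EuclideanSpace ℝ (Fin N)}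
    (hx : 0 < x 0) :
    Gs N s x (ε • e1 N) = kap N s / 2 * ‖x - ε • e1 N‖ ^ (2 * s - (N : ℝ)) *
      greenProfile N s (4 * x 0 * ε / ‖x - ε • e1 N‖ ^ 2) := by
  have h : (ε • e1 N) 0 = ε := by simp [e1]
  rw [Gs, h, if_pos ⟨hx, hε⟩, greenProfile]

lemma measurable_greenRow (N : ℕ) [NeZero N] {s : ℝ} (hs : 0 < s)
    (y : EuclideanSpace ℝ (Fin N)) : Measurable fun x => Gs N s x y := by
  have h0 : Measurable fun x : EuclideanSpace ℝ (Fin N) => x 0 := by fun_prop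
  refine Measurable.ite ((measurableSet_lt measurable_const h0).inter (.const _)) ?_
    measurable_const
  exact Measurable.mul (by fun_prop) ((greenProfile_mono N hs).measurable.comp (by fun_prop))

lemma abs_Gs_le {N : ℕ} [NeZero N] {s b ε : ℝ} (hb : 0 ≤ b) (hbN : b ≤ (N : ℝ) / 2)
    (hbs : b < s) (hε : 0 < ε) {x : EuclideanSpace ℝ (Fin N)} (hx : 0 < x 0)
    (hne : 0 < ‖x - ε • e1 N‖) :
    |Gs N s x (ε • e1 N)| ≤ |kap N s| / 2 * (4 ^ (s - b) / (s - b)) * (x 0) ^ (s - b) *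
      ε ^ (s - b) * ‖x - ε • e1 N‖ ^ (2 * b - (N : ℝ)) := by
  rw [Gs_smul_e1 hε hx]
  set d := ‖x - ε • e1 N‖
  have hg := greenProfile_le (N := N) (s := s) hb hbN hbs (r := 4 * x 0 * ε / d ^ 2)
    (by positivity)
  rw [abs_mul, abs_mul, abs_div, abs_two, abs_of_nonneg (greenProfile_nonneg _ _ _),
    abs_of_nonneg (by positivity : 0 ≤ d ^ (2 * s - (N : ℝ)))]
  refine (mul_le_mul_of_nonneg_left hg (by positivity)).trans_eq ?_
  have e : d ^ (2 * s - (N : ℝ)) = d ^ (2 * b - (N : ℝ)) * (d ^ 2) ^ (s - b) := by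
    rw [← Real.rpow_natCast, ← Real.rpow_mul hne.le, ← Real.rpow_add hne]
    congr 1; push_cast; ring
  rw [e, Real.div_rpow (by positivity) (by positivity), Real.mul_rpow (by positivity) hε.le,
    Real.mul_rpow (by positivity) hx.le]
  field_simp

/-- Near the pole, the rescaled Green kernel is bounded by a translate of `|x|^{s-N}`. -/
lemma abs_rescaled_Gs_le_near {N : ℕ} [NeZero N] {s ε : ℝ} (hs : 0 < s) (hsN : s ≤ N)
    (hε : 0 < ε) {x : EuclideanSpace ℝ (Fin N)} (hx : 0 < x 0) (hx2 : x 0 ≤ 2 * ε)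
    (hne : 0 < ‖x - ε • e1 N‖) :
    |ε ^ (-s) * Gs N s x (ε • e1 N)| ≤
      |kap N s| / 2 * (4 ^ (s / 2) / (s / 2)) * 2 ^ (s / 2) *
        ‖x - ε • e1 N‖ ^ (s - (N : ℝ)) := by
  have h := abs_Gs_le (N := N) (s := s) (b := s / 2) (by positivity) (by linarith) (by linarith)
    hε hx hne
  rw [abs_mul, abs_of_nonneg (by positivity : 0 ≤ ε ^ (-s))]
  rw [sub_half, mul_div_cancel₀ _ two_ne_zero] at h
  have hx3 : (x 0) ^ (s / 2) ≤ 2 ^ (s / 2) * ε ^ (s / 2) := by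
    rw [← Real.mul_rpow two_pos.le hε.le]
    exact Real.rpow_le_rpow hx.le hx2 (by positivity)
  have e : ε ^ (-s) * ε ^ (s / 2) * ε ^ (s / 2) = 1 := by
    rw [← Real.rpow_add hε, ← Real.rpow_add hε]
    ring_nf
    simp
  calc _ ≤ ε ^ (-s) * (|kap N s| / 2 * (4 ^ (s / 2) / (s / 2)) * (2 ^ (s / 2) * ε ^ (s / 2)) *
        ε ^ (s / 2) * ‖x - ε • e1 N‖ ^ (s - (N : ℝ))) := by
        refine mul_le_mul_of_nonneg_left (h.trans ?_) (by positivity)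
        gcongr
    _ = (ε ^ (-s) * ε ^ (s / 2) * ε ^ (s / 2)) * (|kap N s| / 2 * (4 ^ (s / 2) / (s / 2)) *
        2 ^ (s / 2) * ‖x - ε • e1 N‖ ^ (s - (N : ℝ))) := by ring
    _ = _ := by rw [e, one_mul]

/-- Away from the pole, the rescaled Green kernel is bounded by a multiple of `|x|^{s-N}`. -/
lemma abs_rescaled_Gs_le_far {N : ℕ} [NeZero N] {s ε : ℝ} (hs : 0 < s)
    (hε : 0 < ε) {x : EuclideanSpace ℝ (Fin N)} (hx : 0 < x 0) (hx2 : 2 * ε ≤ ‖x‖) :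
    |ε ^ (-s) * Gs N s x (ε • e1 N)| ≤
      |kap N s| / 2 * (4 ^ s / s) * 2 ^ (N : ℝ) * ‖x‖ ^ (s - (N : ℝ)) := by
  have hxn : 0 < ‖x‖ := by linarith
  have hd : ‖x‖ / 2 ≤ ‖x - ε • e1 N‖ := by
    have := norm_sub_norm_le x (ε • e1 N)
    rw [norm_smul_e1 N hε.le] at this
    linarith
  have h := abs_Gs_le (N := N) (s := s) (b := 0) le_rfl (by positivity) hs hε hx
    (by linarith)
  rw [abs_mul, abs_of_nonneg (by positivity : 0 ≤ ε ^ (-s))]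
  simp only [sub_zero, mul_zero, zero_sub] at h
  have e : ε ^ (-s) * ε ^ s = 1 := by
    rw [← Real.rpow_add hε]
    simp
  have h1 : ‖x - ε • e1 N‖ ^ (-(N : ℝ)) ≤ 2 ^ (N : ℝ) * ‖x‖ ^ (-(N : ℝ)) := by
    refine (Real.rpow_le_rpow_of_nonpos (by positivity) hd (by simp)).trans_eq ?_
    rw [Real.div_rpow hxn.le two_pos.le, Real.rpow_neg two_pos.le]
    field_simp
  have h2 : (x 0) ^ s ≤ ‖x‖ ^ s :=
    Real.rpow_le_rpow hx.le ((le_abs_self _).trans (abs_apply_zero_le_norm x)) hs.le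
  calc _ ≤ ε ^ (-s) * (|kap N s| / 2 * (4 ^ s / s) * ‖x‖ ^ s * ε ^ s *
        (2 ^ (N : ℝ) * ‖x‖ ^ (-(N : ℝ)))) := by
        refine mul_le_mul_of_nonneg_left (h.trans ?_) (by positivity)
        gcongr
    _ = (ε ^ (-s) * ε ^ s) * (|kap N s| / 2 * (4 ^ s / s) * 2 ^ (N : ℝ) *
        (‖x‖ ^ s * ‖x‖ ^ (-(N : ℝ)))) := by ring
    _ = _ := by rw [e, one_mul, ← Real.rpow_add hxn, ← sub_eq_add_neg]

lemma tendsto_rescaled_Gs {N : ℕ} [NeZero N] {s : ℝ} (hs : 0 < s)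
    {x : EuclideanSpace ℝ (Fin N)} (hx : 0 < x 0) :
    Tendsto (fun ε : ℝ => ε ^ (-s) * Gs N s x (ε • e1 N)) (𝓝[>] 0) (𝓝 (Ps N s x)) := by
  have hxn : 0 < ‖x‖ := hx.trans_le ((le_abs_self _).trans (abs_apply_zero_le_norm x))
  have hd : Tendsto (fun ε : ℝ => ‖x - ε • e1 N‖) (𝓝[>] 0) (𝓝 ‖x‖) := by
    have : Continuous fun ε : ℝ => ‖x - ε • e1 N‖ := by fun_prop
    simpa using (this.tendsto 0).mono_left nhdsWithin_le_nhds
  have hdpos : ∀ᶠ ε : ℝ in 𝓝[>] 0, 0 < ‖x - ε • e1 N‖ := hd.eventually_const_lt hxn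
  have hr : Tendsto (fun ε : ℝ => 4 * x 0 * ε / ‖x - ε • e1 N‖ ^ 2) (𝓝[>] 0) (𝓝[>] 0) := by
    refine tendsto_nhdsWithin_iff.2 ⟨?_, ?_⟩
    · have h1 : Tendsto (fun ε : ℝ => 4 * x 0 * ε) (𝓝[>] 0) (𝓝 0) := by
        have : Continuous fun ε : ℝ => 4 * x 0 * ε := by fun_prop
        simpa using (this.tendsto 0).mono_left nhdsWithin_le_nhds
      have h2 := h1.div (hd.pow 2) (by positivity)
      rw [zero_div] at h2
      exact h2
    · filter_upwards [hdpos, self_mem_nhdsWithin] with ε h1 (h2 : 0 < ε)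
      simp only [mem_Ioi]
      positivity
  have hlim := ((((hd.rpow_const (p := -(N : ℝ)) (Or.inl hxn.ne'))).mul
    ((tendsto_greenProfile_div N hs).comp hr)).const_mul (kap N s / 2 * 4 ^ s * (x 0) ^ s))
  have hP : Ps N s x = kap N s / 2 * 4 ^ s * (x 0) ^ s * (‖x‖ ^ (-(N : ℝ)) * (1 / s)) := by
    have h4 : (4 : ℝ) ^ s = 2 ^ (2 * s) := by
      rw [Real.rpow_mul two_pos.le]; norm_num
    rw [Ps, if_pos hx, Ks, h4, Real.rpow_sub_one two_ne_zero]
    ring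
  rw [hP]
  refine hlim.congr' ?_
  filter_upwards [hdpos, self_mem_nhdsWithin] with ε h1 (h2 : 0 < ε)
  simp only [Function.comp, Gs_smul_e1 h2 hx]
  set d := ‖x - ε • e1 N‖
  have e : d ^ (2 * s - (N : ℝ)) = d ^ (-(N : ℝ)) * (d ^ 2) ^ s := by
    rw [← Real.rpow_natCast, ← Real.rpow_mul h1.le, ← Real.rpow_add h1]
    congr 1; push_cast; ring
  rw [e, Real.div_rpow (by positivity) (by positivity), Real.mul_rpow (by positivity) h2.le,
    Real.mul_rpow (by positivity) hx.le, Real.rpow_neg h2.le]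
  have := (Real.rpow_pos_of_pos h2 s).ne'
  have := (Real.rpow_pos_of_pos hx s).ne'
  field_simp

lemma measurableSet_halfSpace (N : ℕ) [NeZero N] :
    MeasurableSet {x : EuclideanSpace ℝ (Fin N) | 0 < x 0} :=
  measurableSet_lt measurable_const (by fun_prop)

lemma stronglyMeasurable_pvInt {N : ℕ} (s : ℝ) {u : EuclideanSpace ℝ (Fin N) → ℝ}
    (hu : Measurable u) (ε : ℝ) : StronglyMeasurable fun x => pvInt N s u x ε := by
  refine StronglyMeasurable.integral_prod_right (f := fun x z =>
    (u x - u (x + z)) / ‖z‖ ^ ((N : ℝ) + 2 * s)) ?_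
  refine Measurable.stronglyMeasurable ?_
  simp only [Function.uncurry_def]
  fun_prop

lemma TestFun.aestronglyMeasurable {N : ℕ} [NeZero N] {s : ℝ}
    {φ L : EuclideanSpace ℝ (Fin N) → ℝ} (h : TestFun N s φ L) :
    AEStronglyMeasurable L (volume.restrict {x : EuclideanSpace ℝ (Fin N) | 0 < x 0}) := by
  refine aestronglyMeasurable_of_tendsto_ae atTop
    (f := fun (n : ℕ) x => cns N s * pvInt N s φ x (1 / ((n : ℝ) + 1)))
    (fun n => ((stronglyMeasurable_pvInt s h.cont.measurable _).const_mul _).aestronglyMeasurable)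
    ?_
  refine (ae_restrict_iff' (measurableSet_halfSpace N)).2 (ae_of_all _ fun x hx => ?_)
  refine (h.pv x hx).comp (tendsto_nhdsWithin_iff.2
    ⟨tendsto_one_div_add_atTop_nhds_zero_nat, Eventually.of_forall fun n => ?_⟩)
  simp only [mem_Ioi]
  positivity

/-- Far from the support of `u`, the truncated integrals decay like `|x|^{-N-2s}`. -/
lemma abs_pvInt_le_of_far {N : ℕ} {s : ℝ} (hs : 0 < s) {u : EuclideanSpace ℝ (Fin N) → ℝ}
    {M R : ℝ} (hM : 0 ≤ M) (hR : 0 < R) (hu : ∀ x, |u x| ≤ M)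
    (hsupp : ∀ x, R ≤ ‖x‖ → u x = 0) {x : EuclideanSpace ℝ (Fin N)} (hx : 2 * R ≤ ‖x‖) (ε : ℝ) :
    |pvInt N s u x ε| ≤
      volume.real (Metric.ball (0 : EuclideanSpace ℝ (Fin N)) R) *
        (M * (‖x‖ / 2) ^ (-((N : ℝ) + 2 * s))) := by
  set c := M * (‖x‖ / 2) ^ (-((N : ℝ) + 2 * s))
  have hxn : 0 < ‖x‖ := by linarith
  have hc : 0 ≤ c := by positivity
  have hint : Integrable ((Metric.ball (-x) R).indicator fun _ => c) :=
    (integrable_indicator_iff measurableSet_ball).2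
      (integrableOn_const measure_ball_lt_top.ne)
  have hbound : ∀ z : EuclideanSpace ℝ (Fin N),
      ‖(u x - u (x + z)) / ‖z‖ ^ ((N : ℝ) + 2 * s)‖ ≤
        (Metric.ball (-x) R).indicator (fun _ => c) z := by
    intro z
    rw [hsupp x (by linarith)]
    by_cases hz : z ∈ Metric.ball (-x) R
    · rw [indicator_of_mem hz]
      rw [mem_ball_iff_norm, sub_neg_eq_add] at hz
      have hz2 : ‖x‖ / 2 ≤ ‖z‖ := by
        have := norm_sub_le (z + x) z
        rw [add_sub_cancel_left] at this
        linarith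
      rw [zero_sub, norm_div, norm_neg, div_eq_mul_inv,
        Real.norm_of_nonneg (by positivity : 0 ≤ ‖z‖ ^ ((N : ℝ) + 2 * s)),
        ← Real.rpow_neg (norm_nonneg z)]
      refine mul_le_mul (hu _) (Real.rpow_le_rpow_of_nonpos (by positivity) hz2 ?_)
        (by positivity) hM
      have : (0 : ℝ) ≤ N := by positivity
      linarith
    · rw [indicator_of_notMem hz]
      rw [mem_ball_iff_norm, sub_neg_eq_add, not_lt, add_comm] at hz
      simp [hsupp _ hz]
  calc |pvInt N s u x ε| ≤ ∫ z in annulus N ε, (Metric.ball (-x) R).indicator (fun _ => c) z :=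
        norm_integral_le_of_norm_le hint.integrableOn (ae_of_all _ hbound)
    _ ≤ ∫ z, (Metric.ball (-x) R).indicator (fun _ => c) z :=
        setIntegral_le_integral hint (ae_of_all _ fun z => indicator_nonneg (fun _ _ => hc) z)
    _ = _ := by
        rw [integral_indicator measurableSet_ball, setIntegral_const, smul_eq_mul,
          measureReal_def, measureReal_def, Measure.addHaar_ball_center]

/-- The fractional Laplacian of a test function decays like `(1+|x|)^{-N-2s}`. -/
lemma TestFun.exists_decay {N : ℕ} [NeZero N] {s : ℝ} (hs : 0 < s)
    {φ L : EuclideanSpace ℝ (Fin N) → ℝ} (h : TestFun N s φ L) :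
    ∃ C : ℝ, 0 ≤ C ∧ ∀ x : EuclideanSpace ℝ (Fin N), 0 < x 0 →
      |L x| ≤ C * (1 + ‖x‖) ^ (-((N : ℝ) + 2 * s)) := by
  obtain ⟨M, hM⟩ := h.cpt.exists_bound_of_continuous h.cont
  obtain ⟨R, hR, hsub⟩ := h.cpt.isBounded.subset_ball_lt 1 0
  obtain ⟨C₀, hC₀⟩ := h.bdd
  have hM0 : 0 ≤ M := (norm_nonneg _).trans (hM 0)
  have hsupp : ∀ x, R ≤ ‖x‖ → φ x = 0 := fun x hx =>
    image_eq_zero_of_notMem_tsupport fun hx' => by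
      have := hsub hx'
      rw [mem_ball_zero_iff] at this
      linarith
  have hN0 : (0 : ℝ) ≤ N := by positivity
  set p : ℝ := (N : ℝ) + 2 * s
  have hp : 0 ≤ p := by positivity
  set V := volume.real (Metric.ball (0 : EuclideanSpace ℝ (Fin N)) R)
  have hV : 0 ≤ V := measureReal_nonneg
  refine ⟨|C₀| * (1 + 2 * R) ^ p + |cns N s| * (V * (M * 4 ^ p)), by positivity, fun x hx => ?_⟩
  have hq : (0 : ℝ) < (1 + ‖x‖) ^ (-p) := by positivity
  rw [add_mul]
  rcases le_or_gt (2 * R) ‖x‖ with hfar | hnear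
  · have hlim : |L x| ≤ |cns N s| * (V * (M * (‖x‖ / 2) ^ (-p))) := by
      refine le_of_tendsto (h.pv x hx).abs (Eventually.of_forall fun ε => ?_)
      rw [abs_mul]
      exact mul_le_mul_of_nonneg_left (abs_pvInt_le_of_far hs hM0 (by linarith) hM hsupp hfar ε)
        (abs_nonneg _)
    have hpow : (‖x‖ / 2) ^ (-p) ≤ 4 ^ p * (1 + ‖x‖) ^ (-p) := by
      refine (Real.rpow_le_rpow_of_nonpos (x := (1 + ‖x‖) / 4) (by positivity) (by linarith)
        (by linarith)).trans_eq ?_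
      rw [Real.div_rpow (by positivity) (by positivity), Real.rpow_neg (by norm_num : (0:ℝ) ≤ 4),
        div_inv_eq_mul, mul_comm]
    calc |L x| ≤ |cns N s| * (V * (M * (4 ^ p * (1 + ‖x‖) ^ (-p)))) := by
          refine hlim.trans ?_
          gcongr
      _ = |cns N s| * (V * (M * 4 ^ p)) * (1 + ‖x‖) ^ (-p) := by ring
      _ ≤ _ := le_add_of_nonneg_left (by positivity)
  · have h1 : 1 ≤ (1 + 2 * R) ^ p * (1 + ‖x‖) ^ (-p) := by
      rw [Real.rpow_neg (by positivity), ← div_eq_mul_inv, one_le_div (by positivity)]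
      exact Real.rpow_le_rpow (by positivity) (by linarith) hp
    calc |L x| ≤ |C₀| * 1 := by rw [mul_one]; exact (hC₀ x hx).trans (le_abs_self _)
      _ ≤ |C₀| * ((1 + 2 * R) ^ p * (1 + ‖x‖) ^ (-p)) := by gcongr
      _ = |C₀| * (1 + 2 * R) ^ p * (1 + ‖x‖) ^ (-p) := by ring
      _ ≤ _ := le_add_of_nonneg_right (by positivity)

lemma integrable_indicator_ball_norm_rpow {N : ℕ} [NeZero N] {s : ℝ} (hs : 0 < s) (r : ℝ) :
    Integrable ((Metric.ball (0 : EuclideanSpace ℝ (Fin N)) r).indicator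
      fun x => ‖x‖ ^ (s - (N : ℝ))) := by
  rw [integrable_indicator_iff measurableSet_ball,
    integrableOn_fun_norm_addHaar volume (f := fun t : ℝ => t ^ (s - (N : ℝ)))]
  refine (integrableOn_Ioo_rpow_sub_one hs r).congr_fun (fun t ht => ?_) measurableSet_Ioo
  have h0 : 0 < t := ht.1
  have hN : 1 ≤ N := NeZero.one_le
  simp only [finrank_euclideanSpace, Fintype.card_fin, smul_eq_mul]
  rw [← Real.rpow_natCast, ← Real.rpow_add h0, Nat.cast_sub hN]
  congr 1; push_cast; ring

lemma tendsto_integral_indicator_ball_norm_rpow {N : ℕ} [NeZero N] {s : ℝ} (hs : 0 < s) :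
    Tendsto (fun ε : ℝ => ∫ x, (Metric.ball (0 : EuclideanSpace ℝ (Fin N)) (3 * ε)).indicator
      (fun x => ‖x‖ ^ (s - (N : ℝ))) x) (𝓝[>] 0) (𝓝 0) := by
  suffices h : Tendsto (fun ε : ℝ => ∫ x,
      (Metric.ball (0 : EuclideanSpace ℝ (Fin N)) (3 * ε)).indicator
        (fun x => ‖x‖ ^ (s - (N : ℝ))) x) (𝓝[>] 0)
      (𝓝 (∫ _ : EuclideanSpace ℝ (Fin N), (0 : ℝ))) by
    rwa [integral_zero] at h
  refine tendsto_integral_filter_of_dominated_convergence _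
    (Eventually.of_forall fun ε =>
      (integrable_indicator_ball_norm_rpow hs (3 * ε)).aestronglyMeasurable) ?_
    (integrable_indicator_ball_norm_rpow (N := N) hs 1) ?_
  · filter_upwards [Ioo_mem_nhdsGT (show (0 : ℝ) < 1 / 3 by norm_num)] with ε hε
    refine ae_of_all _ fun x => ?_
    rw [Real.norm_of_nonneg (indicator_nonneg (fun _ _ => by positivity) x)]
    exact indicator_le_indicator_of_subset (Metric.ball_subset_ball (by linarith [hε.2]))
      (fun _ => by positivity) x
  · filter_upwards [Measure.ae_ne volume (0 : EuclideanSpace ℝ (Fin N))] with x hx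
    have hx : 0 < ‖x‖ := norm_pos_iff.2 hx
    refine tendsto_const_nhds.congr' ?_
    filter_upwards [Ioo_mem_nhdsGT (show (0 : ℝ) < ‖x‖ / 3 by positivity)] with ε hε
    rw [indicator_of_notMem]
    rw [mem_ball_zero_iff, not_lt]
    linarith [hε.2]

/-- A dominating function for the rescaled Green kernel against a decaying function. -/
def greenMajorant (N : ℕ) (s : ℝ) (x : EuclideanSpace ℝ (Fin N)) : ℝ :=
  (Metric.ball (0 : EuclideanSpace ℝ (Fin N)) 1).indicator (fun x => ‖x‖ ^ (s - (N : ℝ))) x +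
    (1 + ‖x‖) ^ (-((N : ℝ) + 2 * s))

lemma integrable_greenMajorant (N : ℕ) [NeZero N] {s : ℝ} (hs : 0 < s) :
    Integrable (greenMajorant N s) :=
  (integrable_indicator_ball_norm_rpow hs 1).add (integrable_one_add_norm (by simp; linarith))

lemma norm_rpow_mul_le_greenMajorant {N : ℕ} {s : ℝ} (hs : 0 < s) (hsN : s ≤ N)
    (x : EuclideanSpace ℝ (Fin N)) :
    ‖x‖ ^ (s - (N : ℝ)) * (1 + ‖x‖) ^ (-((N : ℝ) + 2 * s)) ≤ greenMajorant N s x := by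
  have hq : (0 : ℝ) ≤ (1 + ‖x‖) ^ (-((N : ℝ) + 2 * s)) := by positivity
  have hN0 : (0 : ℝ) ≤ N := by positivity
  rw [greenMajorant]
  by_cases hx : x ∈ Metric.ball (0 : EuclideanSpace ℝ (Fin N)) 1
  · rw [indicator_of_mem hx]
    have h1 : (1 + ‖x‖) ^ (-((N : ℝ) + 2 * s)) ≤ 1 :=
      Real.rpow_le_one_of_one_le_of_nonpos (by simp) (by linarith)
    exact (mul_le_of_le_one_right (by positivity) h1).trans (le_add_of_nonneg_right hq)
  · rw [indicator_of_notMem hx, zero_add]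
    rw [mem_ball_zero_iff, not_lt] at hx
    exact mul_le_of_le_one_left hq (Real.rpow_le_one_of_one_le_of_nonpos hx (by linarith))

/-- For every test function `φ ∈ 𝕏_s(ℝ^N_+)` (with `L = (-Δ)^s φ` on `ℝ^N_+`),
`lim_{ε→0⁺} ∫_{ℝ^N_+} ε^{-s} 𝒢_{s,∞}(x, ε e₁) (-Δ)^s φ(x) dx
  = ∫_{ℝ^N_+} 𝒫_s(x) (-Δ)^s φ(x) dx`. -/
theorem green_approx_distributional
    (N : ℕ) [NeZero N] (hN : 2 ≤ N) (s : ℝ) (hs : s ∈ Ioo (0 : ℝ) 1)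
    (φ L : EuclideanSpace ℝ (Fin N) → ℝ) (hφ : TestFun N s φ L) :
    Tendsto (fun ε : ℝ => ∫ x in {x : EuclideanSpace ℝ (Fin N) | 0 < x 0},
        ε ^ (-s) * Gs N s x (ε • e1 N) * L x)
      (𝓝[>] (0 : ℝ))
      (𝓝 (∫ x in {x : EuclideanSpace ℝ (Fin N) | 0 < x 0}, Ps N s x * L x)) := by
  have hs0 : 0 < s := hs.1
  have hsN : s ≤ N := by
    have : (2 : ℝ) ≤ N := by exact_mod_cast hN
    linarith [hs.2]
  obtain ⟨C, hC, hL⟩ := hφ.exists_decay hs0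
  have hLm := hφ.aestronglyMeasurable
  set H : Set (EuclideanSpace ℝ (Fin N)) := {x | 0 < x 0}
  have hH : MeasurableSet H := measurableSet_halfSpace N
  set F : ℝ → EuclideanSpace ℝ (Fin N) → ℝ := fun ε x =>
    ε ^ (-s) * Gs N s x (ε • e1 N) * L x
  set B : ℝ → Set (EuclideanSpace ℝ (Fin N)) := fun ε => Metric.ball 0 (2 * ε)
  have hB : ∀ ε, MeasurableSet (B ε) := fun ε => measurableSet_ball
  have hFm : ∀ ε, AEStronglyMeasurable (F ε) (volume.restrict H) := fun ε =>
    ((measurable_greenRow N hs0 _).const_mul _).aestronglyMeasurable.mul hLm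
  -- the part away from the pole
  set K := |kap N s| / 2 * (4 ^ s / s) * 2 ^ (N : ℝ)
  have hK : 0 ≤ K := by positivity
  have hfar : ∀ ε, 0 < ε → ∀ᵐ x ∂volume.restrict H,
      ‖(B ε)ᶜ.indicator (F ε) x‖ ≤ K * C * greenMajorant N s x := by
    intro ε hε
    refine (ae_restrict_iff' hH).2 (ae_of_all _ fun x hx => ?_)
    have hm := norm_rpow_mul_le_greenMajorant hs0 hsN x
    have hm0 : 0 ≤ greenMajorant N s x := le_trans (by positivity) hm
    by_cases hxB : x ∈ (B ε)ᶜ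
    · rw [indicator_of_mem hxB]
      simp only [B, mem_compl_iff, mem_ball_zero_iff, not_lt] at hxB
      calc ‖F ε x‖ = |ε ^ (-s) * Gs N s x (ε • e1 N)| * |L x| := abs_mul _ _
        _ ≤ K * ‖x‖ ^ (s - (N : ℝ)) * (C * (1 + ‖x‖) ^ (-((N : ℝ) + 2 * s))) :=
          mul_le_mul (abs_rescaled_Gs_le_far hs0 hε hx hxB) (hL x hx) (abs_nonneg _)
            (by positivity)
        _ = K * C * (‖x‖ ^ (s - (N : ℝ)) * (1 + ‖x‖) ^ (-((N : ℝ) + 2 * s))) := by ring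
        _ ≤ _ := by gcongr
    · rw [indicator_of_notMem hxB, norm_zero]
      positivity
  have hmaj : Integrable (fun x => K * C * greenMajorant N s x) (volume.restrict H) :=
    ((integrable_greenMajorant N hs0).const_mul _).integrableOn
  have hfarlim : Tendsto (fun ε => ∫ x in H, (B ε)ᶜ.indicator (F ε) x) (𝓝[>] 0)
      (𝓝 (∫ x in H, Ps N s x * L x)) := by
    refine tendsto_integral_filter_of_dominated_convergence _
      (Eventually.of_forall fun ε => (hFm ε).indicator (hB ε).compl)
      (eventually_nhdsWithin_of_forall hfar) hmaj ?_
    refine (ae_restrict_iff' hH).2 (ae_of_all _ fun x hx => ?_)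
    have hxn : 0 < ‖x‖ :=
      (show 0 < x 0 from hx).trans_le ((le_abs_self _).trans (abs_apply_zero_le_norm x))
    refine ((tendsto_rescaled_Gs hs0 hx).mul_const (L x)).congr' ?_
    filter_upwards [Ioo_mem_nhdsGT (show (0 : ℝ) < ‖x‖ / 2 by positivity)] with ε hε
    rw [indicator_of_mem]
    simp only [B, mem_compl_iff, mem_ball_zero_iff, not_lt]
    linarith [hε.2]
  -- the part close to the pole
  set K' := |kap N s| / 2 * (4 ^ (s / 2) / (s / 2)) * 2 ^ (s / 2)
  have hK' : 0 ≤ K' := by positivity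
  set k : ℝ → EuclideanSpace ℝ (Fin N) → ℝ := fun ε =>
    (Metric.ball (0 : EuclideanSpace ℝ (Fin N)) (3 * ε)).indicator
      fun x => ‖x‖ ^ (s - (N : ℝ))
  have hk0 : ∀ ε x, 0 ≤ k ε x := fun ε x => indicator_nonneg (fun _ _ => by positivity) x
  have hkint : ∀ ε, Integrable fun x => K' * C * k ε (x - ε • e1 N) := fun ε =>
    ((integrable_indicator_ball_norm_rpow hs0 (3 * ε)).comp_sub_right _).const_mul _
  have hnear : ∀ ε, 0 < ε → ∀ᵐ x ∂volume.restrict H,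
      ‖(B ε).indicator (F ε) x‖ ≤ K' * C * k ε (x - ε • e1 N) := by
    intro ε hε
    rw [ae_restrict_iff' hH]
    filter_upwards [Measure.ae_ne volume (ε • e1 N)] with x hne hx
    have hne : 0 < ‖x - ε • e1 N‖ := norm_pos_iff.2 (sub_ne_zero.2 hne)
    by_cases hxB : x ∈ B ε
    · rw [indicator_of_mem hxB]
      simp only [B, mem_ball_zero_iff] at hxB
      have hx2 : x 0 ≤ 2 * ε :=
        ((le_abs_self _).trans (abs_apply_zero_le_norm x)).trans hxB.le
      have hmem : x - ε • e1 N ∈ Metric.ball (0 : EuclideanSpace ℝ (Fin N)) (3 * ε) := by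
        rw [mem_ball_zero_iff]
        have := norm_sub_le x (ε • e1 N)
        rw [norm_smul_e1 N hε.le] at this
        linarith
      have hLC : |L x| ≤ C := (hL x hx).trans (mul_le_of_le_one_right hC
        (Real.rpow_le_one_of_one_le_of_nonpos (by simp) (by linarith)))
      simp only [k]
      rw [indicator_of_mem hmem]
      calc ‖F ε x‖ = |ε ^ (-s) * Gs N s x (ε • e1 N)| * |L x| := abs_mul _ _
        _ ≤ K' * ‖x - ε • e1 N‖ ^ (s - (N : ℝ)) * C :=
          mul_le_mul (abs_rescaled_Gs_le_near hs0 hsN hε hx hx2 hne) hLC (abs_nonneg _)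
            (by positivity)
        _ = _ := by ring
    · rw [indicator_of_notMem hxB, norm_zero]
      have := hk0 ε (x - ε • e1 N)
      positivity
  have hnearlim : Tendsto (fun ε => ∫ x in H, (B ε).indicator (F ε) x) (𝓝[>] 0) (𝓝 0) := by
    have hlim := (tendsto_integral_indicator_ball_norm_rpow (N := N) hs0).const_mul (K' * C)
    rw [mul_zero] at hlim
    refine squeeze_zero_norm' ?_ hlim
    filter_upwards [self_mem_nhdsWithin] with ε hε
    calc _ ≤ ∫ x in H, K' * C * k ε (x - ε • e1 N) :=
          norm_integral_le_of_norm_le (hkint ε).integrableOn (hnear ε hε)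
      _ ≤ ∫ x, K' * C * k ε (x - ε • e1 N) :=
          setIntegral_le_integral (hkint ε)
            (ae_of_all _ fun x => mul_nonneg (by positivity) (hk0 _ _))
      _ = K' * C * ∫ x, k ε x := by
          rw [integral_const_mul, integral_sub_right_eq_self]
  have hsum := hnearlim.add hfarlim
  rw [zero_add] at hsum
  refine hsum.congr' ?_
  filter_upwards [self_mem_nhdsWithin] with ε hε
  rw [← integral_add ((hkint ε).integrableOn.mono' ((hFm ε).indicator (hB ε)) (hnear ε hε))
    (hmaj.mono' ((hFm ε).indicator (hB ε).compl) (hfar ε hε))]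
  exact integral_congr_ae (ae_of_all _ fun x => congrFun (indicator_self_add_compl (B ε) (F ε)) x)
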